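/- ψ₂ makes outputs a function of the inputs: If a set T of infinite traces satisfies ψ₂, then there exists a function g : List (Set I) → Set O such that for every t ∈ T and every k ∈ ℕ, t(k) ∩ O = g(t(0) ∩ I, …, t(k) ∩ I). -/

import Mathlib

/- Common setup: input propositions `Inp`, output propositions `Out`,
   Σ = Inp ⊕ Out (disjoint union).  An event is a subset of Σ. -/

namespace RE

abbrev Event (Inp Out : Type*) := Set (Inp ⊕ Out)
abbrev InfTrace (Inp Out : Type*) := ℕ → Event Inp Out
abbrev FinTrace (Inp Out : Type*) := List (Event Inp Out)
abbrev Hyperproperty (Inp Out : Type*) := Set (Set (InfTrace Inp Out))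

variable {Inp Out : Type*} {n k : ℕ}

/-- input part `e ∩ I` of an event -/
def inPart (e : Event Inp Out) : Set Inp := {a | Sum.inl a ∈ e}

/-- output part `e ∩ O` of an event -/
def outPart (e : Event Inp Out) : Set Out := {b | Sum.inr b ∈ e}

/-- the event `i ∪ o` built from an input part and an output part -/
def evt (i : Set Inp) (o : Set Out) : Event Inp Out :=
  Sum.inl '' i ∪ Sum.inr '' o

/-! ### Parallel trace input model with `n` traces.
A prefix (an `n`-tuple of equally long finite traces) is represented
position-majorly as a list of columns `Fin n → Event`. -/

abbrev PPrefix (Inp Out : Type*) (n : ℕ) := List (Fin n → Event Inp Out)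

/-- a continuation function `List ((Set I)^n) → (Set O)^n` -/
abbrev PCont (Inp Out : Type*) (n : ℕ) :=
  List (Fin n → Set Inp) → (Fin n → Set Out)

/-- a prefixed strategy in the parallel model -/
abbrev PStrategy (Inp Out : Type*) (n : ℕ) := PPrefix Inp Out n → PCont Inp Out n

/-- the `i`-th trace of the run induced by prefix `U`, continuation `f`
and input sequence `v`:
`uᵢ · (v(0)ᵢ ∪ f(ε)ᵢ) · (v(1)ᵢ ∪ f(v(0))ᵢ) · …` -/
def prun (U : PPrefix Inp Out n) (f : PCont Inp Out n)
    (v : ℕ → Fin n → Set Inp) (i : Fin n) : InfTrace Inp Out := fun j =>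
  if h : j < U.length then U.get ⟨j, h⟩ i
  else evt (v (j - U.length) i) (f ((List.range (j - U.length)).map v) i)

/-- the set of the `n` traces of the induced run -/
def prunSet (U : PPrefix Inp Out n) (f : PCont Inp Out n)
    (v : ℕ → Fin n → Set Inp) : Set (InfTrace Inp Out) :=
  Set.range (prun U f v)

/-- `σ(U) = f` is winning for `H` (i.e. not losing) -/
def PContWinning (H : Hyperproperty Inp Out) (U : PPrefix Inp Out n)
    (f : PCont Inp Out n) : Prop :=
  ∀ v : ℕ → Fin n → Set Inp, prunSet U f v ∈ H

/-- `U` is a winning prefix for `H` -/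
def PWinningPrefix (H : Hyperproperty Inp Out) (U : PPrefix Inp Out n) : Prop :=
  ∃ f : PCont Inp Out n, PContWinning H U f

/-- `σ` is a winning strategy for `H`: `σ(ε)` is winning and `σ(U)` is
winning for every winning prefix `U` -/
def PWinningStrategy (H : Hyperproperty Inp Out) (σ : PStrategy Inp Out n) : Prop :=
  PContWinning H [] (σ []) ∧
  ∀ U : PPrefix Inp Out n, PWinningPrefix H U → PContWinning H U (σ U)

/-- a reactive system in the parallel model -/
abbrev PSystem (Inp Out : Type*) (n : ℕ) := PCont Inp Out n

/-- the prefix produced by system `S` on the finite input history `s` -/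
def psysPrefix (S : PSystem Inp Out n) (s : List (Fin n → Set Inp)) :
    PPrefix Inp Out n :=
  List.ofFn (fun j : Fin s.length => fun i => evt (s.get j i) (S (s.take j) i))

/-- soundness of an enforcement mechanism in the parallel model -/
def PSound (H : Hyperproperty Inp Out)
    (enf : PSystem Inp Out n → PSystem Inp Out n) : Prop :=
  ∀ (S : PSystem Inp Out n) (v : ℕ → Fin n → Set Inp),
    prunSet [] (enf S) v ∈ H

/-- `U` is output-safe for `H`: replacing the input part of the `j`-th
event by any input tuple (keeping the output parts, truncating after `j`)
yields a winning prefix -/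
def POutputSafe (H : Hyperproperty Inp Out) (U : PPrefix Inp Out n) : Prop :=
  ∀ (j : ℕ) (h : j < U.length) (i : Fin n → Set Inp),
    PWinningPrefix H
      (U.take j ++ [fun r => evt (i r) (outPart (U.get ⟨j, h⟩ r))])

/-- transparency of an enforcement mechanism in the parallel model -/
def PTransparent (H : Hyperproperty Inp Out)
    (enf : PSystem Inp Out n → PSystem Inp Out n) : Prop :=
  ∀ (S : PSystem Inp Out n) (s s' : List (Fin n → Set Inp)), s <+: s' →
    POutputSafe H (psysPrefix S s) →
    psysPrefix S s <+: psysPrefix (enf S) s'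

/-- the tuple of length-`m` prefixes of an `n`-tuple of infinite traces -/
def ptracePrefix (t : Fin n → InfTrace Inp Out) (m : ℕ) : PPrefix Inp Out n :=
  List.ofFn (fun j : Fin m => fun i => t i (j : ℕ))

/-- `H` has losing counterexamples in the parallel model with `n` traces -/
def PLosingCounterexamples (H : Hyperproperty Inp Out) (n : ℕ) : Prop :=
  ∀ t : Fin n → InfTrace Inp Out,
    (∀ m : ℕ, PWinningPrefix H (ptracePrefix t m)) → Set.range t ∈ H

/-! ### Sequential trace input model. -/

/-- a prefixed strategy in the sequential model -/
abbrev SeqStrategy (Inp Out : Type*) :=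
  List (InfTrace Inp Out) → FinTrace Inp Out → List (Set Inp) → Set Out

/-- the session trace `u · (v(0) ∪ g(ε)) · (v(1) ∪ g(v(0))) · …` -/
def seqSession (g : List (Set Inp) → Set Out) (u : FinTrace Inp Out)
    (v : ℕ → Set Inp) : InfTrace Inp Out := fun j =>
  if h : j < u.length then u.get ⟨j, h⟩
  else evt (v (j - u.length)) (g ((List.range (j - u.length)).map v))

/-- the induced run `t₀, t₁, …` of strategy `σ` from prefix `(U,u)`
on session inputs `V` -/
def seqRun (σ : SeqStrategy Inp Out) (U : List (InfTrace Inp Out))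
    (u : FinTrace Inp Out) (V : ℕ → ℕ → Set Inp) : ℕ → InfTrace Inp Out
  | 0 => seqSession (σ U u) u (V 0)
  | (m + 1) =>
      seqSession
        (σ (U ++ List.ofFn (fun r : Fin (m + 1) => seqRun σ U u V r.val)) [])
        [] (V (m + 1))
  termination_by m => m
  decreasing_by exact r.isLt

/-- the trace set `{t | t ∈ U} ∪ {t₀, t₁, …}` of the induced run -/
def seqRunSet (σ : SeqStrategy Inp Out) (U : List (InfTrace Inp Out))
    (u : FinTrace Inp Out) (V : ℕ → ℕ → Set Inp) : Set (InfTrace Inp Out) :=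
  {t | t ∈ U} ∪ Set.range (seqRun σ U u V)

/-- `σ` is winning with `(U,u)` for `H` (i.e. not losing) -/
def SeqWinningWith (H : Hyperproperty Inp Out) (σ : SeqStrategy Inp Out)
    (U : List (InfTrace Inp Out)) (u : FinTrace Inp Out) : Prop :=
  ∀ V : ℕ → ℕ → Set Inp, seqRunSet σ U u V ∈ H

/-- `(U,u)` is a winning prefix for `H` -/
def SeqWinningPrefix (H : Hyperproperty Inp Out) (U : List (InfTrace Inp Out))
    (u : FinTrace Inp Out) : Prop :=
  ∃ σ : SeqStrategy Inp Out, SeqWinningWith H σ U u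

/-- `σ` is a winning strategy for `H`: winning with `([],ε)` and with
every winning prefix -/
def SeqWinningStrategy (H : Hyperproperty Inp Out) (σ : SeqStrategy Inp Out) : Prop :=
  SeqWinningWith H σ [] [] ∧
  ∀ (U : List (InfTrace Inp Out)) (u : FinTrace Inp Out),
    SeqWinningPrefix H U u → SeqWinningWith H σ U u

/-- a reactive system in the sequential model: it sees the input sequences
of the completed sessions and the input history of the current session -/
abbrev SeqSystem (Inp Out : Type*) :=
  List (ℕ → Set Inp) → List (Set Inp) → Set Out

/-- the trace of one session of system `S` after completed session
inputs `prev`, on session input `v` -/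
def seqSysSession (S : SeqSystem Inp Out) (prev : List (ℕ → Set Inp))
    (v : ℕ → Set Inp) : InfTrace Inp Out := fun j =>
  evt (v j) (S prev ((List.range j).map v))

/-- the `m`-th trace of the run of system `S` on session inputs `V` -/
def seqSysRun (S : SeqSystem Inp Out) (V : ℕ → ℕ → Set Inp) (m : ℕ) :
    InfTrace Inp Out :=
  seqSysSession S ((List.range m).map V) (V m)

/-- the sequential prefix produced by system `S` on completed session
inputs `Vs` and current-session input history `s` -/
def seqSysPrefix (S : SeqSystem Inp Out) (Vs : List (ℕ → Set Inp))
    (s : List (Set Inp)) : List (InfTrace Inp Out) × FinTrace Inp Out :=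
  (List.ofFn (fun m : Fin Vs.length => seqSysSession S (Vs.take m) (Vs.get m)),
   List.ofFn (fun j : Fin s.length => evt (s.get j) (S Vs (s.take j))))

/-- soundness of an enforcement mechanism in the sequential model -/
def SeqSound (H : Hyperproperty Inp Out)
    (enf : SeqSystem Inp Out → SeqSystem Inp Out) : Prop :=
  ∀ (S : SeqSystem Inp Out) (V : ℕ → ℕ → Set Inp),
    Set.range (seqSysRun (enf S) V) ∈ H

/-- length-`j` prefix of an infinite trace as a finite trace -/
def finPrefOf (t : InfTrace Inp Out) (j : ℕ) : FinTrace Inp Out :=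
  List.ofFn (fun r : Fin j => t r.val)

/-- `(U,u)` is output-safe for `H`: replacing the input part of any event
of the run by any input (keeping output parts, truncating right after that
event) yields a winning prefix -/
def SeqOutputSafe (H : Hyperproperty Inp Out) (U : List (InfTrace Inp Out))
    (u : FinTrace Inp Out) : Prop :=
  (∀ (m : ℕ) (h : m < U.length) (j : ℕ) (i : Set Inp),
    SeqWinningPrefix H (U.take m)
      (finPrefOf (U.get ⟨m, h⟩) j ++ [evt i (outPart (U.get ⟨m, h⟩ j))])) ∧
  (∀ (j : ℕ) (h : j < u.length) (i : Set Inp),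
    SeqWinningPrefix H U (u.take j ++ [evt i (outPart (u.get ⟨j, h⟩))]))

/-- the sequential prefix relation `(U,u) ⪯ (V,v)` -/
def SeqPrefixRel (p q : List (InfTrace Inp Out) × FinTrace Inp Out) : Prop :=
  (p.1 = q.1 ∧ p.2 <+: q.2) ∨
  (p.1.length < q.1.length ∧ q.1.take p.1.length = p.1 ∧
    ∀ (j : ℕ) (h : j < p.2.length),
      p.2.get ⟨j, h⟩ = q.1.getD p.1.length (fun _ => (∅ : Event Inp Out)) j)

/-- the analogous prefix relation on session inputs -/
def SeqInputPrefixRel (p q : List (ℕ → Set Inp) × List (Set Inp)) : Prop :=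
  (p.1 = q.1 ∧ p.2 <+: q.2) ∨
  (p.1.length < q.1.length ∧ q.1.take p.1.length = p.1 ∧
    ∀ (j : ℕ) (h : j < p.2.length),
      p.2.get ⟨j, h⟩ = q.1.getD p.1.length (fun _ => (∅ : Set Inp)) j)

/-- transparency of an enforcement mechanism in the sequential model -/
def SeqTransparent (H : Hyperproperty Inp Out)
    (enf : SeqSystem Inp Out → SeqSystem Inp Out) : Prop :=
  ∀ (S : SeqSystem Inp Out) (Vs : List (ℕ → Set Inp)) (s : List (Set Inp))
    (Vs' : List (ℕ → Set Inp)) (s' : List (Set Inp)),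
    SeqInputPrefixRel (Vs, s) (Vs', s') →
    SeqOutputSafe H (seqSysPrefix S Vs s).1 (seqSysPrefix S Vs s).2 →
    SeqPrefixRel (seqSysPrefix S Vs s) (seqSysPrefix (enf S) Vs' s')

/-- `H` has losing counterexamples in the sequential model -/
def SeqLosingCounterexamples (H : Hyperproperty Inp Out) : Prop :=
  ∀ t : ℕ → InfTrace Inp Out,
    (∀ (m j : ℕ),
      SeqWinningPrefix H (List.ofFn (fun r : Fin m => t r.val)) (finPrefOf (t m) j)) →
    Set.range t ∈ H

/-! ### Quantifier-free HyperLTL with trace variables from `Fin k`. -/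

inductive HForm (α : Type*) (k : ℕ) : Type _
  | tt : HForm α k
  | atom : α → Fin k → HForm α k
  | neg : HForm α k → HForm α k
  | disj : HForm α k → HForm α k → HForm α k
  | next : HForm α k → HForm α k
  | until_ : HForm α k → HForm α k → HForm α k

/-- semantics of quantifier-free HyperLTL w.r.t. a trace assignment -/
def HSat {α : Type*} : HForm α k → (Fin k → (ℕ → Set α)) → ℕ → Prop
  | .tt, _, _ => True
  | .atom a p, A, j => a ∈ A p j
  | .neg φ, A, j => ¬ HSat φ A j
  | .disj φ ψ, A, j => HSat φ A j ∨ HSat ψ A j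
  | .next φ, A, j => HSat φ A (j + 1)
  | .until_ φ ψ, A, j =>
      ∃ m, j ≤ m ∧ HSat ψ A m ∧ ∀ l, j ≤ l → l < m → HSat φ A l

/-- `T ⊨ ∀π₁…∀πₖ. φ` -/
def SatForall {α : Type*} (T : Set (ℕ → Set α)) (φ : HForm α k) : Prop :=
  ∀ A : Fin k → (ℕ → Set α), (∀ p, A p ∈ T) → HSat φ A 0

namespace HForm

def conj {α : Type*} (φ ψ : HForm α k) : HForm α k := .neg (.disj (.neg φ) (.neg ψ))

def iff_ {α : Type*} (φ ψ : HForm α k) : HForm α k :=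
  conj (.disj (.neg φ) ψ) (.disj (.neg ψ) φ)

def always {α : Type*} (φ : HForm α k) : HForm α k := .neg (.until_ .tt (.neg φ))

/-- weak until `φ W ψ := (φ U ψ) ∨ G φ` -/
def wuntil {α : Type*} (φ ψ : HForm α k) : HForm α k := .disj (.until_ φ ψ) (always φ)

end HForm

def bigConj {α : Type*} (l : List (HForm α k)) : HForm α k := l.foldr HForm.conj .tt

def bigDisj {α : Type*} (l : List (HForm α k)) : HForm α k :=
  l.foldr HForm.disj (.neg .tt)

/-- the formula `ψ₂ = ∀π.∀π'. (⋀_{o∈O}(o_π ↔ o_{π'})) W (⋁_{i∈I} ¬(i_π ↔ i_{π'}))`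
(its quantifier-free matrix with two trace variables) -/
noncomputable def psi2 (Inp Out : Type*) [Fintype Inp] [Fintype Out] : HForm (Inp ⊕ Out) 2 :=
  HForm.wuntil
    (bigConj ((Finset.univ : Finset Out).toList.map (fun o =>
      HForm.iff_ (.atom (Sum.inr o) 0) (.atom (Sum.inr o) 1))))
    (bigDisj ((Finset.univ : Finset Inp).toList.map (fun i =>
      .neg (HForm.iff_ (.atom (Sum.inl i) 0) (.atom (Sum.inl i) 1)))))

/-- the play of a Moore strategy `f` on an input sequence `v` -/
def play (f : List (Set Inp) → Set Out) (v : ℕ → Set Inp) : InfTrace Inp Out :=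
  fun m => evt (v m) (f ((List.range m).map v))

/-- `∀^k φ` is realizable: some Moore strategy's full set of plays satisfies it -/
def Realizable (φ : HForm (Inp ⊕ Out) k) : Prop :=
  ∃ f : List (Set Inp) → Set Out,
    SatForall (Set.range (fun v : ℕ → Set Inp => play f v)) φ

/-! ### LTL over `Σ × Fin n` and the HyperLTL-to-LTL translation. -/

inductive LTL (β : Type*) : Type _
  | tt : LTL β
  | atom : β → LTL β
  | neg : LTL β → LTL β
  | disj : LTL β → LTL β → LTL β
  | next : LTL β → LTL β
  | until_ : LTL β → LTL β → LTL β

def LSat {β : Type*} : LTL β → (ℕ → Set β) → ℕ → Prop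
  | .tt, _, _ => True
  | .atom b, w, j => b ∈ w j
  | .neg φ, w, j => ¬ LSat φ w j
  | .disj φ ψ, w, j => LSat φ w j ∨ LSat ψ w j
  | .next φ, w, j => LSat φ w (j + 1)
  | .until_ φ ψ, w, j =>
      ∃ m, j ≤ m ∧ LSat ψ w m ∧ ∀ l, j ≤ l → l < m → LSat φ w l

def LTL.conj {β : Type*} (φ ψ : LTL β) : LTL β := .neg (.disj (.neg φ) (.neg ψ))

def lbigConj {β : Type*} (l : List (LTL β)) : LTL β := l.foldr LTL.conj .tt

/-- `φ[ρ]`: replace each atom `a_π` by `(a, ρ(π))` -/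
def trLTL {α : Type*} : HForm α k → (Fin k → Fin n) → LTL (α × Fin n)
  | .tt, _ => .tt
  | .atom a p, ρ => .atom (a, ρ p)
  | .neg φ, ρ => .neg (trLTL φ ρ)
  | .disj φ ψ, ρ => .disj (trLTL φ ρ) (trLTL ψ ρ)
  | .next φ, ρ => .next (trLTL φ ρ)
  | .until_ φ ψ, ρ => .until_ (trLTL φ ρ) (trLTL ψ ρ)

/-- `φ^n_LTL := ⋀_{ρ : Fin k → Fin n} φ[ρ]` -/
noncomputable def phiLTL {α : Type*} (n : ℕ) (φ : HForm α k) : LTL (α × Fin n) :=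
  lbigConj ((Finset.univ : Finset (Fin k → Fin n)).toList.map (fun ρ => trLTL φ ρ))

/-- `zip(t₁,…,tₙ)`: `(a,i) ∈ zip(t)(m)` iff `a ∈ tᵢ(m)` -/
def zipFam {α : Type*} (t : Fin n → (ℕ → Set α)) : ℕ → Set (α × Fin n) :=
  fun m => {p | p.1 ∈ t p.2 m}

/-- event over `Σ × Fin n` built from inputs in `I × Fin n` and
outputs in `O × Fin n` -/
def evtN (i : Set (Inp × Fin n)) (o : Set (Out × Fin n)) :
    Set ((Inp ⊕ Out) × Fin n) :=
  {p | (∃ a, p.1 = Sum.inl a ∧ (a, p.2) ∈ i) ∨ (∃ b, p.1 = Sum.inr b ∧ (b, p.2) ∈ o)}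

end RE

namespace RE

section Semantics

variable {α : Type*} {k : ℕ} {A : Fin k → (ℕ → Set α)} {j : ℕ}

theorem hSat_conj {φ ψ : HForm α k} :
    HSat (φ.conj ψ) A j ↔ HSat φ A j ∧ HSat ψ A j := by
  simp only [HForm.conj, HSat]
  tauto

theorem hSat_iff {φ ψ : HForm α k} :
    HSat (φ.iff_ ψ) A j ↔ (HSat φ A j ↔ HSat ψ A j) := by
  simp only [HForm.iff_, hSat_conj, HSat]
  tauto

theorem hSat_always {φ : HForm α k} :
    HSat φ.always A j ↔ ∀ m, j ≤ m → HSat φ A m := by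
  simp [HForm.always, HSat]

theorem hSat_bigConj {l : List (HForm α k)} :
    HSat (bigConj l) A j ↔ ∀ φ ∈ l, HSat φ A j := by
  induction l with
  | nil => simp [bigConj, HSat]
  | cons φ l ih =>
    rw [List.forall_mem_cons, ← ih]
    exact hSat_conj

theorem hSat_bigDisj {l : List (HForm α k)} :
    HSat (bigDisj l) A j ↔ ∃ φ ∈ l, HSat φ A j := by
  induction l with
  | nil => simp [bigDisj, HSat]
  | cons φ l ih =>
    rw [List.exists_mem_cons_iff, ← ih]
    rfl

end Semantics

variable {Inp Out : Type*}

theorem hSat_psi2 [Fintype Inp] [Fintype Out] {A : Fin 2 → InfTrace Inp Out} {j : ℕ} :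
    HSat (psi2 Inp Out) A j ↔
      (∃ m, j ≤ m ∧ inPart (A 0 m) ≠ inPart (A 1 m) ∧
        ∀ l, j ≤ l → l < m → outPart (A 0 l) = outPart (A 1 l)) ∨
      ∀ m, j ≤ m → outPart (A 0 m) = outPart (A 1 m) := by
  simp only [psi2, HForm.wuntil, HSat, hSat_always, hSat_bigConj, hSat_bigDisj, hSat_iff,
    List.mem_map, exists_exists_eq_and, forall_exists_index, forall_apply_eq_imp_iff,
    Finset.mem_toList, Finset.mem_univ, true_and, ne_eq, Set.ext_iff, inPart, outPart,
    Set.mem_ofPred_eq, not_forall]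

/-- Under `ψ₂`, two traces whose inputs agree up to `k` have the same output at `k`. -/
theorem outPart_eq_of_inPart_eq [Fintype Inp] [Fintype Out] {T : Set (InfTrace Inp Out)}
    (h : SatForall T (psi2 Inp Out)) {s t : InfTrace Inp Out} (hs : s ∈ T) (ht : t ∈ T)
    {k : ℕ} (hst : ∀ j ≤ k, inPart (s j) = inPart (t j)) :
    outPart (s k) = outPart (t k) := by
  have hsat := h ![s, t] (by simp [Fin.forall_fin_two, hs, ht])
  rcases hSat_psi2.mp hsat with ⟨m, -, hne, heq⟩ | heq
  · exact heq k k.zero_le (not_le.mp fun hmk => hne (hst m hmk))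
  · exact heq k k.zero_le

end RE

open RE in
/-- ψ₂ makes outputs a function of the inputs. -/
theorem psi2_outputs_function_of_inputs
    {Inp Out : Type*} [Fintype Inp] [Fintype Out]
    (T : Set (InfTrace Inp Out)) (h : SatForall T (psi2 Inp Out)) :
    ∃ g : List (Set Inp) → Set Out, ∀ t ∈ T, ∀ k : ℕ,
      outPart (t k) = g ((List.range (k + 1)).map (fun j => inPart (t j))) := by
  refine ⟨fun l => {b | ∃ s ∈ T, ∃ m : ℕ,
    (List.range (m + 1)).map (fun j => inPart (s j)) = l ∧ b ∈ outPart (s m)}, ?_⟩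
  intro t ht k
  ext b
  refine ⟨fun hb => ⟨t, ht, k, rfl, hb⟩, ?_⟩
  rintro ⟨s, hs, m, hl, hb⟩
  obtain rfl : m = k := by simpa using congrArg List.length hl
  have hst : ∀ j ≤ m, inPart (s j) = inPart (t j) := fun j hj =>
    List.map_inj_left.mp hl j (List.mem_range.mpr (Nat.lt_succ_of_le hj))
  rwa [← outPart_eq_of_inPart_eq h hs ht hst]
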